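/- Let α < 1, β > 0 with α + β > 1, let δ = β/(α+2β-1) and H = 1/2 + (α+β-1)/(2β), and let a : [0,∞) → [0,∞) be continuous, compactly supported and nonnegative. Define r(s) = ∫₀^∞ e^{-k^{2β} s} a(k) k^{1-2α} dk for s ≥ 0, and set D₀ = 2 a(0) ∫₀^∞ (e^{-k^{2β}} − 1 + k^{2β}) k^{1−2α−4β} dk. Then for all t, τ > 0, lim_{ε → 0⁺} ε² ∫₀^{t/ε^{2δ}} ∫₀^{τ/ε^{2δ}} r(|u − v|) du dv = (D₀/2) (t^{2H} + τ^{2H} − |t − τ|^{2H}). -/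

import Mathlib

open MeasureTheory Real Filter

lemma aux_exp_nonneg (x : ℝ) : 0 ≤ Real.exp (-x) - 1 + x := by
  have := Real.add_one_le_exp (-x); linarith

lemma aux_exp_le (x : ℝ) (hx : 0 ≤ x) : Real.exp (-x) - 1 + x ≤ x ^ 2 := by
  rcases le_total x 1 with h | h
  · have := Real.abs_exp_sub_one_sub_id_le (x := -x) (by rw [abs_neg, abs_of_nonneg hx]; exact h)
    have := le_abs_self (Real.exp (-x) - 1 - -x)
    nlinarith
  · have : Real.exp (-x) ≤ 1 := Real.exp_le_one_iff.mpr (by linarith)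
    nlinarith

lemma aux_exp_le' (x : ℝ) (hx : 0 ≤ x) : Real.exp (-x) - 1 + x ≤ x := by
  have : Real.exp (-x) ≤ 1 := Real.exp_le_one_iff.mpr (by linarith)
  linarith

/-- `∫₀ˣ e^{-c|y|} dy` for nonnegative `x`. -/
lemma aux_P (c : ℝ) (hc : 0 < c) (x : ℝ) (hx : 0 ≤ x) :
    ∫ y in (0:ℝ)..x, Real.exp (-c * |y|) = (1 - Real.exp (-c * x)) / c := by
  have h1 : ∫ y in (0:ℝ)..x, Real.exp (-c * |y|) = ∫ y in (0:ℝ)..x, Real.exp (-c * y) := by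
    apply intervalIntegral.integral_congr
    intro y hy
    rw [Set.uIcc_of_le hx] at hy
    simp only [abs_of_nonneg hy.1]
  rw [h1, intervalIntegral.integral_eq_sub_of_hasDerivAt
    (f := fun y => - Real.exp (-c * y) / c)]
  · simp; ring
  · intro y _
    have : HasDerivAt (fun y => - Real.exp (-c * y) / c)
        (-(Real.exp (-c * y) * (-c * 1)) / c) y :=
      (((hasDerivAt_id' y).const_mul (-c)).exp.neg.div_const c)
    refine this.congr_deriv ?_
    field_simp
  · exact Continuous.intervalIntegrable (by fun_prop) _ _

lemma aux_Pneg (c : ℝ) (x : ℝ) :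
    ∫ y in (0:ℝ)..(-x), Real.exp (-c * |y|) = - ∫ y in (0:ℝ)..x, Real.exp (-c * |y|) := by
  have := intervalIntegral.integral_comp_neg (a := 0) (b := x)
    (f := fun y => Real.exp (-c * |y|))
  simp only [abs_neg, neg_zero] at this
  rw [this, intervalIntegral.integral_symm]

lemma aux_Q (c : ℝ) (hc : 0 < c) (x : ℝ) (hx : 0 ≤ x) :
    ∫ z in (0:ℝ)..x, ∫ y in (0:ℝ)..z, Real.exp (-c * |y|)
      = (Real.exp (-c * x) - 1 + c * x) / c ^ 2 := by
  have h1 : ∫ z in (0:ℝ)..x, ∫ y in (0:ℝ)..z, Real.exp (-c * |y|)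
      = ∫ z in (0:ℝ)..x, (1 - Real.exp (-c * z)) / c := by
    apply intervalIntegral.integral_congr
    intro y hy
    rw [Set.uIcc_of_le hx] at hy
    exact aux_P c hc y hy.1
  rw [h1, intervalIntegral.integral_eq_sub_of_hasDerivAt
    (f := fun y => (Real.exp (-c * y) + c * y) / c ^ 2)]
  · simp; ring
  · intro y _
    have : HasDerivAt (fun y => (Real.exp (-c * y) + c * y) / c ^ 2)
        ((Real.exp (-c * y) * (-c * 1) + c * 1) / c ^ 2) y :=
      ((((hasDerivAt_id' y).const_mul (-c)).exp.add
        ((hasDerivAt_id' y).const_mul c)).div_const (c ^ 2))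
    refine this.congr_deriv ?_
    field_simp
    ring
  · exact Continuous.intervalIntegrable (by fun_prop) _ _

lemma aux_Q_abs (c : ℝ) (hc : 0 < c) (x : ℝ) :
    ∫ z in (0:ℝ)..x, ∫ y in (0:ℝ)..z, Real.exp (-c * |y|)
      = (Real.exp (-c * |x|) - 1 + c * |x|) / c ^ 2 := by
  rw [← aux_Q c hc _ (abs_nonneg x)]
  rcases abs_choice x with h | h
  · rw [h]
  · rw [h]
    have := intervalIntegral.integral_comp_neg (a := 0) (b := x)
      (f := fun z => ∫ y in (0:ℝ)..z, Real.exp (-c * |y|))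
    simp only [aux_Pneg, neg_zero] at this
    rw [intervalIntegral.integral_symm (-x) 0, ← this]
    simp

lemma aux_double (c : ℝ) (hc : 0 < c) (T S : ℝ) (hT : 0 ≤ T) (hS : 0 ≤ S) :
    ∫ u in (0:ℝ)..T, ∫ v in (0:ℝ)..S, Real.exp (-c * |u - v|)
      = (Real.exp (-c * T) - 1 + c * T) / c ^ 2 + (Real.exp (-c * S) - 1 + c * S) / c ^ 2
        - (Real.exp (-c * |T - S|) - 1 + c * |T - S|) / c ^ 2 := by
  have hcont : Continuous (fun y : ℝ => Real.exp (-c * |y|)) := by fun_prop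
  have hi : ∀ p q : ℝ, IntervalIntegrable (fun y : ℝ => Real.exp (-c * |y|)) volume p q :=
    fun p q => hcont.intervalIntegrable p q
  set P : ℝ → ℝ := fun z => ∫ y in (0:ℝ)..z, Real.exp (-c * |y|) with hP
  have hPc : Continuous P := intervalIntegral.continuous_primitive hi 0
  have hPi : ∀ p q : ℝ, IntervalIntegrable P volume p q :=
    fun p q => hPc.intervalIntegrable p q
  have h1 : ∀ u, ∫ v in (0:ℝ)..S, Real.exp (-c * |u - v|) = P u - P (u - S) := by
    intro u
    rw [intervalIntegral.integral_comp_sub_left (fun y => Real.exp (-c * |y|)) u, sub_zero]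
    exact (intervalIntegral.integral_interval_sub_left (hi _ _) (hi _ _)).symm
  simp only [h1]
  have hPs : IntervalIntegrable (fun u => P (u - S)) volume 0 T :=
    Continuous.intervalIntegrable (by fun_prop) _ _
  rw [intervalIntegral.integral_sub (hPi _ _) hPs,
    intervalIntegral.integral_comp_sub_right (fun y => P y) S,
    ← intervalIntegral.integral_interval_sub_left (hPi 0 (T - S)) (hPi 0 (0 - S))]
  rw [aux_Q_abs c hc T, aux_Q_abs c hc (T - S), aux_Q_abs c hc (0 - S)]
  rw [zero_sub, abs_neg, abs_of_nonneg hT, abs_of_nonneg hS]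
  ring

/-- The kernel of the limiting constant is integrable. -/
lemma aux_kernel_int (α β : ℝ) (hα : α < 1) (hβ : 0 < β) (hαβ : 1 < α + β) :
    IntegrableOn (fun k : ℝ =>
      (Real.exp (-(k ^ (2*β))) - 1 + k ^ (2*β)) * k ^ (1 - 2*α - 4*β)) (Set.Ioi 0) := by
  have hm : Measurable (fun k : ℝ =>
      (Real.exp (-(k ^ (2*β))) - 1 + k ^ (2*β)) * k ^ (1 - 2*α - 4*β)) := by fun_prop
  rw [← Set.Ioc_union_Ioi_eq_Ioi (zero_le_one (α := ℝ))]
  apply IntegrableOn.union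
  · have hg : IntegrableOn (fun k : ℝ => k ^ (1 - 2*α)) (Set.Ioc 0 1) := by
      rw [← intervalIntegrable_iff_integrableOn_Ioc_of_le zero_le_one]
      exact intervalIntegral.intervalIntegrable_rpow' (by linarith)
    refine hg.mono' hm.aestronglyMeasurable ?_
    refine (ae_restrict_mem measurableSet_Ioc).mono ?_
    intro k hk
    have hk0 : 0 < k := hk.1
    have hx : 0 ≤ k ^ (2*β) := (rpow_pos_of_pos hk0 _).le
    have hp : 0 ≤ k ^ (1 - 2*α - 4*β) := (rpow_pos_of_pos hk0 _).le
    rw [Real.norm_eq_abs, abs_of_nonneg (mul_nonneg (aux_exp_nonneg _) hp)]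
    calc _ ≤ (k ^ (2*β)) ^ 2 * k ^ (1 - 2*α - 4*β) :=
          mul_le_mul_of_nonneg_right (aux_exp_le _ hx) hp
      _ = k ^ (1 - 2*α) := by
          rw [← rpow_natCast, ← rpow_mul hk0.le, ← rpow_add hk0]
          congr 1; push_cast; ring
  · have hg : IntegrableOn (fun k : ℝ => k ^ (1 - 2*α - 2*β)) (Set.Ioi 1) :=
      integrableOn_Ioi_rpow_of_lt (by linarith) one_pos
    refine hg.mono' hm.aestronglyMeasurable ?_
    refine (ae_restrict_mem measurableSet_Ioi).mono ?_
    intro k hk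
    have hk0 : 0 < k := one_pos.trans hk
    have hx : 0 ≤ k ^ (2*β) := (rpow_pos_of_pos hk0 _).le
    have hp : 0 ≤ k ^ (1 - 2*α - 4*β) := (rpow_pos_of_pos hk0 _).le
    rw [Real.norm_eq_abs, abs_of_nonneg (mul_nonneg (aux_exp_nonneg _) hp)]
    calc _ ≤ k ^ (2*β) * k ^ (1 - 2*α - 4*β) :=
          mul_le_mul_of_nonneg_right (aux_exp_le' _ hx) hp
      _ = k ^ (1 - 2*α - 2*β) := by
          rw [← rpow_add hk0]
          congr 1; ring

lemma aux_a_int (α : ℝ) (hα : α < 1) (a : ℝ → ℝ) (ha_cont : Continuous a)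
    (ha_supp : HasCompactSupport a) :
    IntegrableOn (fun k : ℝ => a k * k ^ (1 - 2*α)) (Set.Ioi 0) := by
  obtain ⟨M, hM⟩ := ha_supp.exists_bound_of_continuous ha_cont
  obtain ⟨R, hR⟩ := ha_supp.isCompact.isBounded.subset_closedBall (0:ℝ)
  have hR1 : (0:ℝ) ≤ max R 1 := le_trans zero_le_one (le_max_right _ _)
  rw [← Set.Ioc_union_Ioi_eq_Ioi hR1]
  apply IntegrableOn.union
  · have hg : IntegrableOn (fun k : ℝ => k ^ (1 - 2*α)) (Set.Ioc 0 (max R 1)) := by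
      rw [← intervalIntegrable_iff_integrableOn_Ioc_of_le hR1]
      exact intervalIntegral.intervalIntegrable_rpow' (by linarith)
    exact hg.bdd_mul ha_cont.aestronglyMeasurable (Eventually.of_forall hM)
  · have : IntegrableOn (fun _ : ℝ => (0:ℝ)) (Set.Ioi (max R 1)) := integrableOn_zero
    refine this.congr_fun ?_ measurableSet_Ioi
    intro k hk
    have : a k = 0 := by
      by_contra h
      have h2 := hR (subset_tsupport a h)
      rw [Metric.mem_closedBall, dist_zero_right, Real.norm_eq_abs] at h2
      have h3 : R < k := (le_max_left R 1).trans_lt hk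
      linarith [le_abs_self k]
    simp [this]

/-- The diagonal functional. -/
noncomputable def auxG (α β : ℝ) (a : ℝ → ℝ) (T : ℝ) : ℝ :=
  ∫ k in Set.Ioi (0:ℝ),
    (Real.exp (-(k ^ (2*β)) * T) - 1 + k ^ (2*β) * T) * a k * k ^ (1 - 2*α - 4*β)

lemma auxG_int (α β : ℝ) (hα : α < 1) (a : ℝ → ℝ) (ha_cont : Continuous a)
    (ha_supp : HasCompactSupport a) (T : ℝ) (hT : 0 ≤ T) :
    IntegrableOn (fun k : ℝ =>
      (Real.exp (-(k ^ (2*β)) * T) - 1 + k ^ (2*β) * T) * a k * k ^ (1 - 2*α - 4*β))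
      (Set.Ioi 0) := by
  have hm : Measurable (fun k : ℝ =>
      (Real.exp (-(k ^ (2*β)) * T) - 1 + k ^ (2*β) * T) * a k * k ^ (1 - 2*α - 4*β)) := by
    have := ha_cont.measurable
    fun_prop
  refine (((aux_a_int α hα a ha_cont ha_supp).norm).const_mul (T ^ 2)).mono'
    hm.aestronglyMeasurable ?_
  refine (ae_restrict_mem measurableSet_Ioi).mono ?_
  intro k hk
  have hk0 : 0 < k := hk
  have hx : 0 ≤ k ^ (2*β) := (rpow_pos_of_pos hk0 _).le
  have hp : 0 ≤ k ^ (1 - 2*α - 4*β) := (rpow_pos_of_pos hk0 _).le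
  have hp' : 0 ≤ k ^ (1 - 2*α) := (rpow_pos_of_pos hk0 _).le
  have e1 : k ^ (1 - 2*α) = (k ^ (2*β)) ^ 2 * k ^ (1 - 2*α - 4*β) := by
    rw [← rpow_natCast, ← rpow_mul hk0.le, ← rpow_add hk0]
    congr 1; push_cast; ring
  rw [neg_mul, norm_mul, norm_mul, norm_mul, Real.norm_of_nonneg hp, Real.norm_of_nonneg hp',
    Real.norm_of_nonneg (aux_exp_nonneg _)]
  calc _ ≤ (k ^ (2*β) * T) ^ 2 * ‖a k‖ * k ^ (1 - 2*α - 4*β) := by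
        gcongr
        exact aux_exp_le _ (by positivity)
    _ = _ := by rw [e1]; ring

lemma auxG_scale (α β : ℝ) (hβ : 0 < β) (a : ℝ → ℝ) (T : ℝ) (hT : 0 < T) :
    auxG α β a T = T ^ (2 + (α - 1) / β) * ∫ k in Set.Ioi (0:ℝ),
      (Real.exp (-(k ^ (2*β))) - 1 + k ^ (2*β)) * k ^ (1 - 2*α - 4*β)
        * a (T ^ (-(1 / (2*β))) * k) := by
  set b := T ^ (-(1 / (2*β))) with hb
  have hb0 : 0 < b := rpow_pos_of_pos hT _
  have h := integral_comp_mul_left_Ioi (fun k : ℝ =>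
    (Real.exp (-(k ^ (2*β)) * T) - 1 + k ^ (2*β) * T) * a k * k ^ (1 - 2*α - 4*β)) 0 hb0
  rw [mul_zero, smul_eq_mul] at h
  have h2 : auxG α β a T = b * ∫ x in Set.Ioi (0:ℝ),
      (Real.exp (-((b * x) ^ (2*β)) * T) - 1 + (b * x) ^ (2*β) * T) * a (b * x)
        * (b * x) ^ (1 - 2*α - 4*β) := by
    rw [h, auxG, ← mul_assoc, mul_inv_cancel₀ hb0.ne', one_mul]
  have hbT : b ^ (2*β) * T = 1 := by
    rw [hb, ← rpow_mul hT.le, ← rpow_add_one hT.ne']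
    have : -(1 / (2 * β)) * (2 * β) + 1 = 0 := by field_simp; ring
    rw [this, rpow_zero]
  have hbp : b * b ^ (1 - 2*α - 4*β) = T ^ (2 + (α - 1) / β) := by
    rw [hb, ← rpow_mul hT.le, ← rpow_add hT]
    congr 1
    field_simp
    ring
  rw [h2, ← hbp, mul_assoc, ← integral_const_mul (b ^ (1 - 2*α - 4*β))]
  congr 1
  apply setIntegral_congr_fun measurableSet_Ioi
  intro x hx
  have hx0 : 0 ≤ x := le_of_lt hx
  have e : (b * x) ^ (2*β) * T = x ^ (2*β) := by
    rw [mul_rpow hb0.le hx0, mul_right_comm, hbT, one_mul]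
  simp only [neg_mul, e]
  rw [mul_rpow hb0.le hx0]
  ring

lemma auxG_lim (α β : ℝ) (hα : α < 1) (hβ : 0 < β) (hαβ : 1 < α + β)
    (a : ℝ → ℝ) (ha_cont : Continuous a) (ha_supp : HasCompactSupport a) :
    Tendsto (fun T => ∫ k in Set.Ioi (0:ℝ),
      (Real.exp (-(k ^ (2*β))) - 1 + k ^ (2*β)) * k ^ (1 - 2*α - 4*β)
        * a (T ^ (-(1 / (2*β))) * k)) atTop
      (nhds ((∫ k in Set.Ioi (0:ℝ),
        (Real.exp (-(k ^ (2*β))) - 1 + k ^ (2*β)) * k ^ (1 - 2*α - 4*β)) * a 0)) := by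
  obtain ⟨M, hM⟩ := ha_supp.exists_bound_of_continuous ha_cont
  rw [← integral_mul_const]
  have hI := aux_kernel_int α β hα hβ hαβ
  refine tendsto_integral_filter_of_dominated_convergence
    (fun k => ‖(Real.exp (-(k ^ (2*β))) - 1 + k ^ (2*β)) * k ^ (1 - 2*α - 4*β)‖ * M)
    (Eventually.of_forall fun T => ?_) (Eventually.of_forall fun T => ?_)
    (hI.norm.mul_const M) ?_
  · exact hI.aestronglyMeasurable.mul
      (ha_cont.comp (continuous_const.mul continuous_id)).aestronglyMeasurable
  · refine Eventually.of_forall fun k => ?_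
    rw [norm_mul]
    exact mul_le_mul_of_nonneg_left (hM _) (norm_nonneg _)
  · refine Eventually.of_forall fun k => ?_
    refine Tendsto.const_mul _ ?_
    have h1 : Tendsto (fun T : ℝ => T ^ (-(1 / (2*β))) * k) atTop (nhds 0) := by
      simpa using (tendsto_rpow_neg_atTop (y := 1 / (2*β)) (by positivity)).mul_const k
    exact (ha_cont.tendsto 0).comp h1

lemma aux_fubini (α β : ℝ) (hα : α < 1)
    (a : ℝ → ℝ) (ha_cont : Continuous a) (ha_supp : HasCompactSupport a)
    (T S : ℝ) (hT : 0 ≤ T) (hS : 0 ≤ S) :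
    ∫ u in (0:ℝ)..T, ∫ v in (0:ℝ)..S, ∫ k in Set.Ioi (0:ℝ),
        Real.exp (-(k ^ (2*β)) * |u - v|) * a k * k ^ (1 - 2*α)
      = auxG α β a T + auxG α β a S - auxG α β a |T - S| := by
  have hI := aux_a_int α hα a ha_cont ha_supp
  have ham := ha_cont.measurable
  set μ := volume.restrict (Set.Ioc (0:ℝ) T) with hμ
  set ν := volume.restrict (Set.Ioc (0:ℝ) S) with hν
  set κ := volume.restrict (Set.Ioi (0:ℝ)) with hκ
  have hF : Integrable (fun p : (ℝ × ℝ) × ℝ =>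
      Real.exp (-(p.2 ^ (2*β)) * |p.1.1 - p.1.2|) * a p.2 * p.2 ^ (1 - 2*α))
      ((μ.prod ν).prod κ) := by
    have hg : Integrable (fun p : (ℝ × ℝ) × ℝ => ‖a p.2 * p.2 ^ (1 - 2*α)‖)
      ((μ.prod ν).prod κ) := (Integrable.comp_snd hI (μ.prod ν)).norm
    refine hg.mono' (Measurable.aestronglyMeasurable (by fun_prop)) ?_
    have hpos : ∀ᵐ p ∂((μ.prod ν).prod κ), (0:ℝ) < p.2 := by
      have : ∀ᵐ k ∂κ, (0:ℝ) < k := ae_restrict_mem measurableSet_Ioi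
      exact Measure.quasiMeasurePreserving_snd.ae this
    filter_upwards [hpos] with p hp
    rw [mul_assoc, norm_mul]
    refine mul_le_of_le_one_left (norm_nonneg _) ?_
    rw [Real.norm_of_nonneg (Real.exp_pos _).le, Real.exp_le_one_iff, neg_mul]
    have : 0 ≤ p.2 ^ (2*β) * |p.1.1 - p.1.2| :=
      mul_nonneg (rpow_pos_of_pos hp _).le (abs_nonneg _)
    linarith
  have h1 : ∫ u in (0:ℝ)..T, ∫ v in (0:ℝ)..S, ∫ k in Set.Ioi (0:ℝ),
        Real.exp (-(k ^ (2*β)) * |u - v|) * a k * k ^ (1 - 2*α)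
      = ∫ p, ∫ k, Real.exp (-(k ^ (2*β)) * |p.1 - p.2|) * a k * k ^ (1 - 2*α) ∂κ
          ∂(μ.prod ν) := by
    rw [integral_prod _ hF.integral_prod_left, intervalIntegral.integral_of_le hT]
    simp only [intervalIntegral.integral_of_le hS]
    rfl
  rw [h1, integral_integral_swap hF]
  have h2 : ∀ k ∈ Set.Ioi (0:ℝ),
      ∫ p, Real.exp (-(k ^ (2*β)) * |p.1 - p.2|) * a k * k ^ (1 - 2*α) ∂(μ.prod ν)
      = (Real.exp (-(k ^ (2*β)) * T) - 1 + k ^ (2*β) * T) * a k * k ^ (1 - 2*α - 4*β)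
        + (Real.exp (-(k ^ (2*β)) * S) - 1 + k ^ (2*β) * S) * a k * k ^ (1 - 2*α - 4*β)
        - (Real.exp (-(k ^ (2*β)) * |T - S|) - 1 + k ^ (2*β) * |T - S|) * a k
          * k ^ (1 - 2*α - 4*β) := by
    intro k hk
    have hk0 : 0 < k := hk
    have hc : 0 < k ^ (2*β) := rpow_pos_of_pos hk0 _
    have e1 : k ^ (1 - 2*α) = (k ^ (2*β)) ^ 2 * k ^ (1 - 2*α - 4*β) := by
      rw [← rpow_natCast, ← rpow_mul hk0.le, ← rpow_add hk0]
      congr 1; push_cast; ring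
    have hE : Integrable (fun p : ℝ × ℝ => Real.exp (-(k ^ (2*β)) * |p.1 - p.2|))
        (μ.prod ν) := by
      refine (integrable_const (1:ℝ)).mono' (Measurable.aestronglyMeasurable (by fun_prop)) ?_
      refine Eventually.of_forall fun p => ?_
      rw [Real.norm_of_nonneg (Real.exp_pos _).le, Real.exp_le_one_iff, neg_mul]
      have := mul_nonneg hc.le (abs_nonneg (p.1 - p.2))
      linarith
    have h3 := aux_double _ hc T S hT hS
    rw [intervalIntegral.integral_of_le hT] at h3
    simp only [intervalIntegral.integral_of_le hS] at h3
    rw [integral_mul_const, integral_mul_const, integral_prod _ hE, h3, e1]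
    field_simp
  rw [hκ, setIntegral_congr_fun measurableSet_Ioi h2]
  have i1 := auxG_int α β hα a ha_cont ha_supp T hT
  have i2 := auxG_int α β hα a ha_cont ha_supp S hS
  have i3 := auxG_int α β hα a ha_cont ha_supp |T - S| (abs_nonneg _)
  have i12 : Integrable (fun k : ℝ =>
      (Real.exp (-(k ^ (2*β)) * T) - 1 + k ^ (2*β) * T) * a k * k ^ (1 - 2*α - 4*β)
      + (Real.exp (-(k ^ (2*β)) * S) - 1 + k ^ (2*β) * S) * a k * k ^ (1 - 2*α - 4*β))
      (volume.restrict (Set.Ioi 0)) := i1.add i2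
  rw [integral_sub i12 i3, integral_add i1 i2]
  rfl

theorem stmt_13 (α β δ H : ℝ) (hα : α < 1) (hβ : 0 < β) (hαβ : 1 < α + β)
    (hδ : δ = β / (α + 2*β - 1)) (hH : H = 1/2 + (α + β - 1) / (2*β))
    (a : ℝ → ℝ) (ha_cont : Continuous a) (ha_supp : HasCompactSupport a)
    (ha_nonneg : ∀ x, 0 ≤ a x)
    (r : ℝ → ℝ)
    (hr : ∀ s : ℝ, 0 ≤ s →
      r s = ∫ k in Set.Ioi (0:ℝ), Real.exp (-(k ^ (2*β)) * s) * a k * k ^ (1 - 2*α))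
    (D₀ : ℝ)
    (hD₀ : D₀ = 2 * a 0 *
      ∫ k in Set.Ioi (0:ℝ),
        (Real.exp (-(k ^ (2*β))) - 1 + k ^ (2*β)) * k ^ (1 - 2*α - 4*β))
    (t τ : ℝ) (ht : 0 < t) (hτ : 0 < τ) :
    Tendsto
      (fun ε : ℝ => ε^2 *
        ∫ u in (0:ℝ)..(t / ε ^ (2*δ)), ∫ v in (0:ℝ)..(τ / ε ^ (2*δ)), r |u - v|)
      (nhdsWithin 0 (Set.Ioi 0))
      (nhds ((D₀ / 2) * (t ^ (2*H) + τ ^ (2*H) - |t - τ| ^ (2*H)))) := by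
  have hden : 0 < α + 2*β - 1 := by linarith
  have hδ0 : 0 < δ := by rw [hδ]; positivity
  have h2H : 2 * H = 2 + (α - 1) / β := by rw [hH]; field_simp; ring
  have hH0 : 0 < 2 * H := by
    rw [hH]
    have : 0 < (α + β - 1) / (2*β) := div_pos (by linarith) (by linarith)
    linarith
  have hδH : 2 * δ * (2 * H) = 2 := by
    rw [h2H, hδ]; field_simp; ring
  -- one-variable limit
  have key : ∀ x : ℝ, 0 ≤ x → Tendsto (fun ε : ℝ => ε ^ 2 * auxG α β a (x / ε ^ (2*δ)))
      (nhdsWithin 0 (Set.Ioi 0)) (nhds ((D₀ / 2) * x ^ (2*H))) := by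
    intro x hx
    rcases hx.eq_or_lt with rfl | hx
    · simp [auxG, zero_rpow hH0.ne']
    have hpow : Tendsto (fun ε : ℝ => ε ^ (2*δ)) (nhdsWithin 0 (Set.Ioi 0))
        (nhdsWithin 0 (Set.Ioi 0)) := by
      refine tendsto_nhdsWithin_iff.mpr ⟨?_, ?_⟩
      · have : ContinuousAt (fun ε : ℝ => ε ^ (2*δ)) 0 :=
          Real.continuousAt_rpow_const _ _ (Or.inr (by positivity))
        have h := this.tendsto
        rw [zero_rpow (by positivity)] at h
        exact h.mono_left nhdsWithin_le_nhds
      · filter_upwards [self_mem_nhdsWithin] with ε hε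
        exact rpow_pos_of_pos hε _
    have htop : Tendsto (fun ε : ℝ => x / ε ^ (2*δ)) (nhdsWithin 0 (Set.Ioi 0)) atTop := by
      simp only [div_eq_mul_inv]
      exact (tendsto_inv_nhdsGT_zero.comp hpow).const_mul_atTop hx
    have hl := ((auxG_lim α β hα hβ hαβ a ha_cont ha_supp).comp htop).const_mul (x ^ (2*H))
    have hval : D₀ / 2 * x ^ (2*H) = x ^ (2*H) * ((∫ k in Set.Ioi (0:ℝ),
        (Real.exp (-(k ^ (2*β))) - 1 + k ^ (2*β)) * k ^ (1 - 2*α - 4*β)) * a 0) := by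
      rw [hD₀]; ring
    rw [hval]
    refine hl.congr' ?_
    filter_upwards [self_mem_nhdsWithin] with ε hε
    have hε0 : 0 < ε := hε
    have hT : 0 < x / ε ^ (2*δ) := div_pos hx (rpow_pos_of_pos hε0 _)
    rw [auxG_scale α β hβ a _ hT, ← h2H, ← mul_assoc, div_rpow hx.le (rpow_pos_of_pos hε0 _).le,
      ← rpow_mul hε0.le, hδH, rpow_two, mul_div_cancel₀ _ (pow_pos hε0 2).ne']
    rfl
  have hlim := ((key t ht.le).add (key τ hτ.le)).sub (key |t - τ| (abs_nonneg _))
  rw [← mul_add, ← mul_sub] at hlim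
  refine hlim.congr' ?_
  filter_upwards [self_mem_nhdsWithin] with ε hε
  have hp : 0 < ε ^ (2*δ) := rpow_pos_of_pos hε _
  simp only [hr _ (abs_nonneg _)]
  rw [aux_fubini α β hα a ha_cont ha_supp _ _ (div_pos ht hp).le (div_pos hτ hp).le,
    ← sub_div, abs_div, abs_of_pos hp]
  ring
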